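/- arXiv:2306.15963 — 7 statements merged into one kernel-verified Lean document; each statement's English description precedes it below -/
import Mathlib

section
/- Let A1 be a real n1×n1 matrix, A2 a real n2×n2 matrix, D a real n1×n2 matrix, α ∈ [0,1], μ1 ∈ ℝ^{n1}, μ2 ∈ ℝ^{n2}, and π a real n1×n2 matrix whose row sums equal μ1 and whose column sums equal μ2. Then the fused Gromov–Wasserstein objective value Σ_{i,j} [ (1−α)·D(i,j) + α·Σ_{k,ℓ} (A1(i,k) − A2(j,ℓ))²·π(k,ℓ) ] · π(i,j) equals α·( Σ_{i,k} A1(i,k)²·μ1(i)·μ1(k) + Σ_{j,ℓ} A2(j,ℓ)²·μ2(j)·μ2(ℓ) ) + (1−α)·Σ_{i,j} D(i,j)·π(i,j) − 2α·Σ_{i,j,k,ℓ} A1(i,k)·A2(j,ℓ)·π(i,j)·π(k,ℓ). In particular, on the set of couplings with marginals μ1 and μ2, the fused Gromov–Wasserstein objective differs from the function f(π) = (1−α)·Σ_{i,j} D(i,j)·π(i,j) − 2α·Σ_{i,j,k,ℓ} A1(i,k)·A2(j,ℓ)·π(i,j)·π(k,ℓ) by a constant independent of π. -/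
section Marginals

variable {ι κ R : Type*} [Fintype ι] [Fintype κ]

theorem sum_sum_mul_of_row_sums [NonUnitalNonAssocSemiring R] {π : Matrix ι κ R} {μ : ι → R}
    (hrow : ∀ i, ∑ j, π i j = μ i) (f : ι → R) :
    ∑ i, ∑ j, f i * π i j = ∑ i, f i * μ i := by
  simp only [← Finset.mul_sum, hrow]

theorem sum_sum_mul_of_col_sums [NonUnitalNonAssocSemiring R] {π : Matrix ι κ R} {ν : κ → R}
    (hcol : ∀ j, ∑ i, π i j = ν j) (g : κ → R) :
    ∑ i, ∑ j, g j * π i j = ∑ j, g j * ν j := by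
  rw [Finset.sum_comm]
  simp only [← Finset.mul_sum, hcol]

variable [CommRing R] {π : Matrix ι κ R} {μ : ι → R} {ν : κ → R}

theorem sum_sum_sub_sq_mul_of_marginals (hrow : ∀ i, ∑ j, π i j = μ i)
    (hcol : ∀ j, ∑ i, π i j = ν j) (a : ι → R) (b : κ → R) :
    ∑ k, ∑ l, (a k - b l) ^ 2 * π k l =
      ∑ k, a k ^ 2 * μ k + ∑ l, b l ^ 2 * ν l - 2 * ∑ k, ∑ l, a k * b l * π k l := by
  rw [← sum_sum_mul_of_row_sums hrow, ← sum_sum_mul_of_col_sums hcol]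
  simp only [Finset.mul_sum, ← Finset.sum_add_distrib, ← Finset.sum_sub_distrib]
  refine Finset.sum_congr rfl fun k _ => Finset.sum_congr rfl fun l _ => ?_
  ring

theorem fgw_objective_eq_of_marginals (hrow : ∀ i, ∑ j, π i j = μ i)
    (hcol : ∀ j, ∑ i, π i j = ν j) (A : Matrix ι ι R) (B : Matrix κ κ R)
    (D : Matrix ι κ R) (α : R) :
    ∑ i, ∑ j, ((1 - α) * D i j + α * ∑ k, ∑ l, (A i k - B j l) ^ 2 * π k l) * π i j =
      α * ((∑ i, ∑ k, A i k ^ 2 * μ i * μ k) + ∑ j, ∑ l, B j l ^ 2 * ν j * ν l)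
        + (1 - α) * (∑ i, ∑ j, D i j * π i j)
        - 2 * α * ∑ i, ∑ j, ∑ k, ∑ l, A i k * B j l * π i j * π k l := by
  have hA : ∑ i, ∑ k, A i k ^ 2 * μ i * μ k = ∑ i, ∑ j, (∑ k, A i k ^ 2 * μ k) * π i j := by
    rw [sum_sum_mul_of_row_sums hrow fun i => ∑ k, A i k ^ 2 * μ k]
    simp only [Finset.sum_mul, mul_right_comm]
  have hB : ∑ j, ∑ l, B j l ^ 2 * ν j * ν l = ∑ i, ∑ j, (∑ l, B j l ^ 2 * ν l) * π i j := by
    rw [sum_sum_mul_of_col_sums hcol fun j => ∑ l, B j l ^ 2 * ν l]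
    simp only [Finset.sum_mul, mul_right_comm]
  have hAB : ∑ i, ∑ j, ∑ k, ∑ l, A i k * B j l * π i j * π k l =
      ∑ i, ∑ j, (∑ k, ∑ l, A i k * B j l * π k l) * π i j := by
    simp only [Finset.sum_mul, mul_right_comm]
  simp only [sum_sum_sub_sq_mul_of_marginals hrow hcol]
  rw [hA, hB, hAB, ← Finset.sum_add_distrib]
  simp only [← Finset.sum_add_distrib]
  rw [Finset.mul_sum, Finset.mul_sum, Finset.mul_sum, ← Finset.sum_add_distrib,
    ← Finset.sum_sub_distrib]
  refine Finset.sum_congr rfl fun i _ => ?_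
  rw [Finset.mul_sum, Finset.mul_sum, Finset.mul_sum, ← Finset.sum_add_distrib,
    ← Finset.sum_sub_distrib]
  refine Finset.sum_congr rfl fun j _ => ?_
  ring

end Marginals

/-- **FGW objective: closed form and equivalence up to an additive constant.**
For any coupling `π` with row sums `μ1` and column sums `μ2`, the fused
Gromov–Wasserstein objective equals the stated closed form; in particular, on the
set of couplings of `(μ1, μ2)`, the FGW objective differs from
`f(π) = (1−α)·Σ D(i,j)π(i,j) − 2α·Σ A1(i,k)A2(j,ℓ)π(i,j)π(k,ℓ)`
by a constant independent of `π`. -/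
theorem fgw_objective_closed_form {n1 n2 : ℕ}
    (A1 : Matrix (Fin n1) (Fin n1) ℝ) (A2 : Matrix (Fin n2) (Fin n2) ℝ)
    (D : Matrix (Fin n1) (Fin n2) ℝ) (α : ℝ) (hα : α ∈ Set.Icc (0 : ℝ) 1)
    (μ1 : Fin n1 → ℝ) (μ2 : Fin n2 → ℝ) (π : Matrix (Fin n1) (Fin n2) ℝ)
    (hrow : ∀ i, ∑ j, π i j = μ1 i) (hcol : ∀ j, ∑ i, π i j = μ2 j) :
    (∑ i, ∑ j, ((1 - α) * D i j
        + α * ∑ k, ∑ ℓ, (A1 i k - A2 j ℓ) ^ 2 * π k ℓ) * π i j =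
      α * ((∑ i, ∑ k, (A1 i k) ^ 2 * μ1 i * μ1 k)
          + ∑ j, ∑ ℓ, (A2 j ℓ) ^ 2 * μ2 j * μ2 ℓ)
        + (1 - α) * (∑ i, ∑ j, D i j * π i j)
        - 2 * α * ∑ i, ∑ j, ∑ k, ∑ ℓ, A1 i k * A2 j ℓ * π i j * π k ℓ)
    ∧ ∃ c : ℝ, ∀ π' : Matrix (Fin n1) (Fin n2) ℝ,
        (∀ i, ∑ j, π' i j = μ1 i) → (∀ j, ∑ i, π' i j = μ2 j) →
        ∑ i, ∑ j, ((1 - α) * D i j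
            + α * ∑ k, ∑ ℓ, (A1 i k - A2 j ℓ) ^ 2 * π' k ℓ) * π' i j =
          ((1 - α) * (∑ i, ∑ j, D i j * π' i j)
            - 2 * α * ∑ i, ∑ j, ∑ k, ∑ ℓ, A1 i k * A2 j ℓ * π' i j * π' k ℓ) + c := by
  refine ⟨fgw_objective_eq_of_marginals hrow hcol A1 A2 D α,
    α * ((∑ i, ∑ k, A1 i k ^ 2 * μ1 i * μ1 k) + ∑ j, ∑ ℓ, A2 j ℓ ^ 2 * μ2 j * μ2 ℓ),
    fun π' hrow' hcol' => ?_⟩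
  rw [fgw_objective_eq_of_marginals hrow' hcol' A1 A2 D α, add_sub_assoc, add_comm]
end

section
/- Let ñ, n1, n2 be positive integers, λ ∈ [0,1], μ̃ ∈ ℝ^{ñ} a vector with strictly positive entries, A1 a real n1×n1 matrix, A2 a real n2×n2 matrix, and π1 ∈ ℝ^{ñ×n1}, π2 ∈ ℝ^{ñ×n2} matrices with nonnegative entries whose row sums both equal μ̃ (i.e., Σ_j π1(i,j) = Σ_j π2(i,j) = μ̃(i) for all i). Define F(Ã) = λ·Σ_{i,k,j,ℓ} (Ã(i,k) − A1(j,ℓ))²·π1(i,j)·π1(k,ℓ) + (1−λ)·Σ_{i,k,j,ℓ} (Ã(i,k) − A2(j,ℓ))²·π2(i,j)·π2(k,ℓ) for real ñ×ñ matrices Ã. Then the matrix Ã* with entries Ã*(i,k) = ( λ·(π1·A1·π1ᵀ)(i,k) + (1−λ)·(π2·A2·π2ᵀ)(i,k) ) / ( μ̃(i)·μ̃(k) ) satisfies F(Ã*) ≤ F(Ã) for every real ñ×ñ matrix Ã. -/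
open Matrix in
/-- Expansion, in powers of `x`, of the cost contributed by one entry of the structure matrix. -/
theorem sum_sq_sub_mul_coupling {l m : Type*} [Fintype m]
    (A : Matrix m m ℝ) (P : Matrix l m ℝ) (i k : l) (x : ℝ) :
    ∑ a, ∑ b, (x - A a b) ^ 2 * P i a * P k b =
      x ^ 2 * ((∑ a, P i a) * ∑ b, P k b) - 2 * x * (P * A * Pᵀ) i k
        + ∑ a, ∑ b, A a b ^ 2 * P i a * P k b := by
  have hmul : (P * A * Pᵀ) i k = ∑ a, ∑ b, P i a * A a b * P k b := by
    simp only [mul_apply, transpose_apply, Finset.sum_mul]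
    exact Finset.sum_comm
  rw [hmul, Finset.sum_mul_sum]
  simp only [Finset.mul_sum, ← Finset.sum_sub_distrib, ← Finset.sum_add_distrib]
  refine Finset.sum_congr rfl fun a _ => Finset.sum_congr rfl fun b _ => ?_
  ring


/-- **Exact analytical minimizer of the outer-loop structure update.**
With couplings `π1, π2` whose common first marginal is `μ̃` (entrywise positive),
the matrix `Ã*(i,k) = (λ·(π1·A1·π1ᵀ)(i,k) + (1−λ)·(π2·A2·π2ᵀ)(i,k))/(μ̃(i)·μ̃(k))`
minimizes the weighted sum of Gromov–Wasserstein structure costs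
`F(Ã) = λ·Σ (Ã(i,k) − A1(j,ℓ))²π1(i,j)π1(k,ℓ)
       + (1−λ)·Σ (Ã(i,k) − A2(j,ℓ))²π2(i,j)π2(k,ℓ)`. -/
theorem fgw_structure_update_minimizer {nt n1 n2 : ℕ}
    (hnt : 0 < nt) (hn1 : 0 < n1) (hn2 : 0 < n2)
    (lam : ℝ) (hlam : lam ∈ Set.Icc (0 : ℝ) 1)
    (μt : Fin nt → ℝ) (hμt : ∀ i, 0 < μt i)
    (A1 : Matrix (Fin n1) (Fin n1) ℝ) (A2 : Matrix (Fin n2) (Fin n2) ℝ)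
    (π1 : Matrix (Fin nt) (Fin n1) ℝ) (π2 : Matrix (Fin nt) (Fin n2) ℝ)
    (hπ1 : ∀ i j, 0 ≤ π1 i j) (hπ2 : ∀ i j, 0 ≤ π2 i j)
    (hrow1 : ∀ i, ∑ j, π1 i j = μt i) (hrow2 : ∀ i, ∑ j, π2 i j = μt i)
    (F : Matrix (Fin nt) (Fin nt) ℝ → ℝ)
    (hF : ∀ At : Matrix (Fin nt) (Fin nt) ℝ,
      F At = lam * (∑ i, ∑ k, ∑ j, ∑ ℓ, (At i k - A1 j ℓ) ^ 2 * π1 i j * π1 k ℓ)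
        + (1 - lam) * ∑ i, ∑ k, ∑ j, ∑ ℓ, (At i k - A2 j ℓ) ^ 2 * π2 i j * π2 k ℓ)
    (Astar : Matrix (Fin nt) (Fin nt) ℝ)
    (hAstar : ∀ i k, Astar i k =
      (lam * (π1 * A1 * π1.transpose) i k
        + (1 - lam) * (π2 * A2 * π2.transpose) i k) / (μt i * μt k)) :
    ∀ At : Matrix (Fin nt) (Fin nt) ℝ, F Astar ≤ F At := by
  intro At
  rw [hF, hF]
  simp only [sum_sq_sub_mul_coupling, hrow1, hrow2]
  rw [Finset.mul_sum, Finset.mul_sum, Finset.mul_sum, Finset.mul_sum,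
    ← Finset.sum_add_distrib, ← Finset.sum_add_distrib]
  refine Finset.sum_le_sum fun i _ => ?_
  rw [Finset.mul_sum, Finset.mul_sum, Finset.mul_sum, Finset.mul_sum,
    ← Finset.sum_add_distrib, ← Finset.sum_add_distrib]
  refine Finset.sum_le_sum fun k _ => ?_
  have hpos : 0 < μt i * μt k := mul_pos (hμt i) (hμt k)
  have hA := hAstar i k
  rw [eq_div_iff hpos.ne'] at hA
  have hsq : 0 ≤ (At i k - Astar i k) ^ 2 * (μt i * μt k) :=
    mul_nonneg (sq_nonneg _) hpos.le
  linear_combination hsq - 2 * (At i k - Astar i k) * hA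
end

section
/- Let μ ∈ ℝ^n and ν ∈ ℝ^m be probability vectors with strictly positive entries summing to 1, and let π₁ be a real n×m matrix with strictly positive entries. Define the Sinkhorn iterates by π_{2t}(i,j) = π_{2t−1}(i,j)·ν(j)/(Σ_{i'} π_{2t−1}(i',j)) (column rescaling, the KL projection onto matrices with column sums ν) and π_{2t+1}(i,j) = π_{2t}(i,j)·μ(i)/(Σ_{j'} π_{2t}(i,j')) (row rescaling, the KL projection onto matrices with row sums μ). Then there exists a matrix π* with strictly positive entries, row sums μ and column sums ν, and a constant C > 0, such that for all t ≥ 1: H(π_t | π*) + H(π* | π_t) ≤ C/t, where H(p|q) = Σ_{i,j} p(i,j)·log(p(i,j)/q(i,j)). In particular the Sinkhorn iterates converge to the unique optimal solution π* at rate O(t^{−1}) in symmetrized KL divergence. -/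
open Finset Filter Topology

/-- A positive function on a finite type is bounded below by a positive constant. -/
lemma exists_pos_forall_le_of_finite {α : Type*} [Finite α] (f : α → ℝ) (hf : ∀ x, 0 < f x) :
    ∃ c, 0 < c ∧ ∀ x, c ≤ f x := by
  cases isEmpty_or_nonempty α
  · exact ⟨1, one_pos, fun x => isEmptyElim x⟩
  · obtain ⟨x, hx⟩ := Finite.exists_min f
    exact ⟨f x, hf x, hx⟩

/-- A real function on a finite type is bounded above by a nonnegative constant. -/
lemma exists_nonneg_forall_ge_of_finite {α : Type*} [Finite α] (f : α → ℝ) :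
    ∃ c, 0 ≤ c ∧ ∀ x, f x ≤ c := by
  cases isEmpty_or_nonempty α
  · exact ⟨0, le_rfl, fun x => isEmptyElim x⟩
  · obtain ⟨x, hx⟩ := Finite.exists_max f
    exact ⟨max 0 (f x), le_max_left _ _, fun y => (hx y).trans (le_max_right _ _)⟩

/-- Averaging against probability weights bounded below by `ε` contracts the relative
oscillation of a positive function by the factor `1 - ε`. -/
lemma sum_mul_le_of_oscillation {ι : Type*} [Fintype ι] {w w' f : ι → ℝ} {ε δ : ℝ}
    (hε : 0 ≤ ε) (hδ : 0 ≤ δ) (hw : ∀ i, ε ≤ w i) (hw' : ∀ i, 0 ≤ w' i)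
    (hwsum : ∑ i, w i = 1) (hwsum' : ∑ i, w' i = 1)
    (hf : ∀ i, 0 < f i) (hosc : ∀ i i', f i ≤ (1 + δ) * f i') :
    ∑ i, w i * f i ≤ (1 + (1 - ε) * δ) * ∑ i, w' i * f i := by
  have : Nonempty ι := by
    by_contra h
    rw [not_nonempty_iff] at h
    simp at hwsum
  obtain ⟨i₀, hi₀⟩ := Finite.exists_min f
  have hε1 : ε ≤ 1 := (hw i₀).trans
    (hwsum ▸ single_le_sum (f := w) (fun i _ => hε.trans (hw i)) (mem_univ i₀))
  have hlow : f i₀ ≤ ∑ i, w' i * f i := by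
    calc f i₀ = ∑ i, w' i * f i₀ := by rw [← sum_mul, hwsum', one_mul]
      _ ≤ _ := sum_le_sum fun i _ => mul_le_mul_of_nonneg_left (hi₀ i) (hw' i)
  have hup : ∑ i, w i * ((1 + δ) * f i₀ - f i) ≥ ε * (δ * f i₀) := by
    calc ε * (δ * f i₀) ≤ w i₀ * ((1 + δ) * f i₀ - f i₀) := by
          have : (1 + δ) * f i₀ - f i₀ = δ * f i₀ := by ring
          rw [this]
          exact mul_le_mul_of_nonneg_right (hw i₀) (mul_nonneg hδ (hf i₀).le)
      _ ≤ _ := single_le_sum (f := fun i => w i * ((1 + δ) * f i₀ - f i))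
          (fun i _ => mul_nonneg (hε.trans (hw i)) (sub_nonneg.2 (hosc i i₀))) (mem_univ i₀)
  have hsum : ∑ i, w i * ((1 + δ) * f i₀ - f i) = (1 + δ) * f i₀ - ∑ i, w i * f i := by
    simp_rw [mul_sub]
    rw [sum_sub_distrib, ← sum_mul, hwsum, one_mul]
  have h0 : 0 ≤ 1 + (1 - ε) * δ := by nlinarith
  calc ∑ i, w i * f i ≤ (1 + (1 - ε) * δ) * f i₀ := by nlinarith
    _ ≤ _ := mul_le_mul_of_nonneg_left hlow h0

/-- If `P` has column sums `ν` and its rows are rescaled by `u`, the factors restoring the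
column sums oscillate less than `u`. -/
lemma rescaling_oscillation_le {ι κ : Type*} [Fintype ι] {P : ι → κ → ℝ}
    {u : ι → ℝ} {v ν : κ → ℝ} {ε δ : ℝ} (hε : 0 ≤ ε) (hδ : 0 ≤ δ)
    (hP : ∀ i j, 0 < P i j) (hν : ∀ j, 0 < ν j)
    (hcol : ∀ j, ∑ i, P i j = ν j) (hlow : ∀ i j, ε * ν j ≤ P i j)
    (hu : ∀ i, 0 < u i) (hosc : ∀ i i', u i ≤ (1 + δ) * u i')
    (hv : ∀ j, v j = ν j / ∑ i, P i j * u i) (j j' : κ) :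
    v j ≤ (1 + (1 - ε) * δ) * v j' := by
  have hι : (univ : Finset ι).Nonempty := by
    rw [nonempty_iff_ne_empty]
    intro h
    have := hcol j
    rw [h, sum_empty] at this
    exact (hν j).ne this
  have hpos : ∀ j, 0 < ∑ i, P i j * u i := fun j =>
    sum_pos (fun i _ => mul_pos (hP i j) (hu i)) hι
  have hinv : ∀ j, v j = (∑ i, P i j / ν j * u i)⁻¹ := by
    intro j
    rw [hv j]
    have : ∑ i, P i j / ν j * u i = (∑ i, P i j * u i) / ν j := by
      rw [sum_div]
      exact sum_congr rfl fun i _ => by ring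
    rw [this, inv_div]
  have havg : ∀ j, 0 < ∑ i, P i j / ν j * u i := fun j =>
    sum_pos (fun i _ => mul_pos (div_pos (hP i j) (hν j)) (hu i)) hι
  have key := sum_mul_le_of_oscillation (w := fun i => P i j' / ν j') (w' := fun i => P i j / ν j)
    hε hδ (fun i => (le_div_iff₀ (hν j')).2 (hlow i j'))
    (fun i => (div_pos (hP i j) (hν j)).le)
    (by rw [← sum_div, hcol, div_self (hν j').ne'])
    (by rw [← sum_div, hcol, div_self (hν j).ne']) hu hosc
  rw [hinv j, hinv j', ← div_eq_mul_inv, le_div_iff₀ (havg j'), inv_mul_le_iff₀ (havg j), mul_comm]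
  exact key

/-- The ratio of two probability vectors with relative oscillation `δ` is within `δ` of `1`
on the logarithmic scale. -/
lemma abs_log_le_of_oscillation {ι : Type*} [Fintype ι] {a r f : ι → ℝ} {δ : ℝ} (hδ : 0 ≤ δ)
    (hr : ∀ i, 0 < r i) (hasum : ∑ i, a i = 1) (hrsum : ∑ i, r i = 1)
    (hf : ∀ i, f i = a i / r i) (hfpos : ∀ i, 0 < f i)
    (hosc : ∀ i i', f i ≤ (1 + δ) * f i') (i : ι) : |Real.log (f i)| ≤ δ := by
  have hfr : ∀ i, f i * r i = a i := fun i => by rw [hf, div_mul_cancel₀ _ (hr i).ne']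
  have h1 : f i ≤ 1 + δ := by
    calc f i = ∑ i', f i * r i' := by rw [← mul_sum, hrsum, mul_one]
      _ ≤ ∑ i', (1 + δ) * a i' := sum_le_sum fun i' _ => by
          rw [← hfr i', ← mul_assoc]
          exact mul_le_mul_of_nonneg_right (hosc i i') (hr i').le
      _ = 1 + δ := by rw [← mul_sum, hasum, mul_one]
  have h2 : 1 ≤ (1 + δ) * f i := by
    calc 1 = ∑ i', a i' := hasum.symm
      _ ≤ ∑ i', (1 + δ) * f i * r i' := sum_le_sum fun i' _ => by
          rw [← hfr i']
          exact mul_le_mul_of_nonneg_right (hosc i' i) (hr i').le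
      _ = (1 + δ) * f i := by rw [← mul_sum, hrsum, mul_one]
  have h3 : Real.log (1 + δ) ≤ δ := by
    have := Real.log_le_sub_one_of_pos (show 0 < 1 + δ by linarith)
    linarith
  have h4 := Real.log_le_log (hfpos i) h1
  have h5 := Real.log_nonneg h2
  rw [Real.log_mul (by linarith) (hfpos i).ne'] at h5
  rw [abs_le]
  constructor <;> linarith

/-- All cross ratios of the matrix `P` are at least `c`. -/
def CrossRatioGe {ι κ : Type*} (c : ℝ) (P : ι → κ → ℝ) : Prop :=
  ∀ i i' j j', c * (P i' j * P i j') ≤ P i j * P i' j'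

lemma CrossRatioGe.swap {ι κ : Type*} {c : ℝ} {P : ι → κ → ℝ} (h : CrossRatioGe c P) :
    CrossRatioGe c (fun j i => P i j) := by
  intro j j' i i'
  have := h i i' j j'
  linarith

lemma CrossRatioGe.mul_row {ι κ : Type*} {c : ℝ} {P Q : ι → κ → ℝ} {u : ι → ℝ}
    (h : CrossRatioGe c P) (hu : ∀ i, 0 < u i) (hQ : ∀ i j, Q i j = P i j * u i) :
    CrossRatioGe c Q := by
  intro i i' j j'
  simp only [hQ]
  have := mul_le_mul_of_nonneg_right (h i i' j j') (mul_pos (hu i) (hu i')).le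
  linarith

lemma CrossRatioGe.mul_col {ι κ : Type*} {c : ℝ} {P Q : ι → κ → ℝ} {v : κ → ℝ}
    (h : CrossRatioGe c P) (hv : ∀ j, 0 < v j) (hQ : ∀ i j, Q i j = P i j * v j) :
    CrossRatioGe c Q :=
  (h.swap.mul_row (Q := fun j i => Q i j) hv fun j i => hQ i j).swap

lemma exists_crossRatioGe {ι κ : Type*} [Finite ι] [Finite κ] {P : ι → κ → ℝ}
    (hP : ∀ i j, 0 < P i j) : ∃ c, 0 < c ∧ CrossRatioGe c P := by
  obtain ⟨c, hc, h⟩ := exists_pos_forall_le_of_finite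
    (fun x : (ι × ι) × (κ × κ) => P x.1.1 x.2.1 * P x.1.2 x.2.2 / (P x.1.2 x.2.1 * P x.1.1 x.2.2))
    (fun x => div_pos (mul_pos (hP _ _) (hP _ _)) (mul_pos (hP _ _) (hP _ _)))
  refine ⟨c, hc, fun i i' j j' => ?_⟩
  have := h ((i, i'), (j, j'))
  rwa [le_div_iff₀ (mul_pos (hP _ _) (hP _ _))] at this

/-- A matrix with row sums `μ` and cross ratios at least `c` dominates `c` times the product of
`μ` with its own column sums. -/
lemma CrossRatioGe.mul_sum_le {ι κ : Type*} [Fintype ι] [Fintype κ] {c : ℝ} {P : ι → κ → ℝ}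
    {μ : ι → ℝ} (h : CrossRatioGe c P) (hrow : ∀ i, ∑ j, P i j = μ i) (hμ : ∑ i, μ i = 1)
    (i : ι) (j : κ) : c * μ i * ∑ i', P i' j ≤ P i j := by
  calc c * μ i * ∑ i', P i' j = ∑ i', ∑ j', c * (P i' j * P i j') := by
        simp_rw [← mul_sum, hrow, ← sum_mul]
        ring
    _ ≤ ∑ i', ∑ j', P i j * P i' j' :=
        sum_le_sum fun i' _ => sum_le_sum fun j' _ => h i i' j j'
    _ = P i j := by simp_rw [← mul_sum, hrow, hμ, mul_one]

/-- `Q` is obtained from `P` by rescaling its columns to have sums `ν`. -/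
def IsColRescaling {ι κ : Type*} [Fintype ι] (ν : κ → ℝ) (P Q : ι → κ → ℝ) : Prop :=
  ∀ i j, Q i j = P i j * (ν j / ∑ i', P i' j)

namespace IsColRescaling

variable {ι κ : Type*} [Fintype ι] {ν : κ → ℝ} {P Q : ι → κ → ℝ}

lemma factor_pos [Nonempty ι] (hν : ∀ j, 0 < ν j) (hP : ∀ i j, 0 < P i j) (j : κ) :
    0 < ν j / ∑ i', P i' j :=
  div_pos (hν j) (sum_pos (fun i _ => hP i j) univ_nonempty)

lemma pos [Nonempty ι] (h : IsColRescaling ν P Q) (hν : ∀ j, 0 < ν j) (hP : ∀ i j, 0 < P i j)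
    (i : ι) (j : κ) : 0 < Q i j := by
  rw [h i j]
  exact mul_pos (hP i j) (factor_pos hν hP j)

lemma sum_eq [Nonempty ι] (h : IsColRescaling ν P Q) (hP : ∀ i j, 0 < P i j) (j : κ) :
    ∑ i, Q i j = ν j := by
  simp_rw [h _ j]
  rw [← sum_mul, mul_div_cancel₀]
  exact (sum_pos (fun i _ => hP i j) univ_nonempty).ne'

lemma crossRatioGe [Nonempty ι] {c : ℝ} (h : IsColRescaling ν P Q) (hν : ∀ j, 0 < ν j)
    (hP : ∀ i j, 0 < P i j) (hc : CrossRatioGe c P) : CrossRatioGe c Q :=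
  hc.mul_col (factor_pos hν hP) h

lemma le [Nonempty ι] [Fintype κ] {c : ℝ} {μ : ι → ℝ} (h : IsColRescaling ν P Q)
    (hν : ∀ j, 0 < ν j) (hP : ∀ i j, 0 < P i j) (hc : CrossRatioGe c P)
    (hrow : ∀ i, ∑ j, P i j = μ i) (hμ : ∑ i, μ i = 1) (i : ι) (j : κ) :
    c * μ i * ν j ≤ Q i j := by
  have hs : 0 < ∑ i', P i' j := sum_pos (fun i _ => hP i j) univ_nonempty
  have := mul_le_mul_of_nonneg_right (hc.mul_sum_le hrow hμ i j) (factor_pos hν hP j).le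
  rw [h i j]
  refine le_trans (le_of_eq ?_) this
  field_simp

end IsColRescaling

/-- Alternating row and column rescalings converge geometrically on the logarithmic scale. -/
lemma exists_log_limit_geometric {ι κ : Type*} [Fintype ι] [Fintype κ] [Nonempty ι] [Nonempty κ]
    {μ : ι → ℝ} {ν : κ → ℝ} (hμ : ∀ i, 0 < μ i) (hν : ∀ j, 0 < ν j)
    (hμsum : ∑ i, μ i = 1) (hνsum : ∑ j, ν j = 1) {A B : ℕ → ι → κ → ℝ} {c : ℝ} (hc : 0 < c)
    (hA0 : ∀ i j, 0 < A 0 i j) (hrow0 : ∀ i, ∑ j, A 0 i j = μ i)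
    (hcr0 : CrossRatioGe c (A 0)) (hlow0 : ∀ i j, c * μ i * ν j ≤ A 0 i j)
    (hB : ∀ k, IsColRescaling ν (A k) (B k))
    (hA : ∀ k, IsColRescaling μ (fun j i => B k i j) (fun j i => A (k + 1) i j)) :
    ∃ (L : ι → κ → ℝ) (D ρ : ℝ), 0 ≤ D ∧ 0 ≤ ρ ∧ ρ < 1 ∧ ∀ k i j,
      |Real.log (A k i j) - L i j| ≤ D * ρ ^ k ∧ |Real.log (B k i j) - L i j| ≤ D * ρ ^ k := by
  have hAk : ∀ k, (∀ i j, 0 < A k i j) ∧ (∀ i, ∑ j, A k i j = μ i) ∧ CrossRatioGe c (A k) ∧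
      ∀ i j, c * μ i * ν j ≤ A k i j := by
    intro k
    induction k with
    | zero => exact ⟨hA0, hrow0, hcr0, hlow0⟩
    | succ k ih =>
      obtain ⟨hpos, -, hcr, -⟩ := ih
      have hBpos := (hB k).pos hν hpos
      have hBcr := ((hB k).crossRatioGe hν hpos hcr).swap
      refine ⟨fun i j => (hA k).pos hμ (fun j i => hBpos i j) j i,
        fun i => (hA k).sum_eq (fun j i => hBpos i j) i,
        ((hA k).crossRatioGe hμ (fun j i => hBpos i j) hBcr).swap, fun i j => ?_⟩
      have := (hA k).le hμ (fun j i => hBpos i j) hBcr ((hB k).sum_eq hpos) hνsum j i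
      linarith
  have hApos := fun k => (hAk k).1
  have hArow := fun k => (hAk k).2.1
  have hAcr := fun k => (hAk k).2.2.1
  have hAlow := fun k => (hAk k).2.2.2
  have hBpos := fun k => (hB k).pos hν (hApos k)
  have hBcol := fun k => (hB k).sum_eq (hApos k)
  have hBlow := fun k => (hB k).le hν (hApos k) (hAcr k) (hArow k) hμsum
  set v : ℕ → κ → ℝ := fun k j => ν j / ∑ i, A k i j with hvdef
  set u : ℕ → ι → ℝ := fun k i => μ i / ∑ j, B k i j with hudef
  have hvpos : ∀ k j, 0 < v k j := fun k => IsColRescaling.factor_pos hν (hApos k)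
  have hupos : ∀ k i, 0 < u k i := fun k =>
    IsColRescaling.factor_pos hμ (fun j i => hBpos k i j)
  obtain ⟨p, hp, hpμ⟩ := exists_pos_forall_le_of_finite μ hμ
  obtain ⟨q, hq, hqν⟩ := exists_pos_forall_le_of_finite ν hν
  set ε : ℝ := min (1 / 2) (min (c * p) (c * q)) with hεdef
  have hε : 0 < ε := lt_min (by norm_num) (lt_min (mul_pos hc hp) (mul_pos hc hq))
  have hε2 : ε ≤ 1 / 2 := min_le_left _ _
  have hεμ : ∀ i, ε ≤ c * μ i := fun i => (min_le_right _ _).trans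
    ((min_le_left _ _).trans (mul_le_mul_of_nonneg_left (hpμ i) hc.le))
  have hεν : ∀ j, ε ≤ c * ν j := fun j => (min_le_right _ _).trans
    ((min_le_right _ _).trans (mul_le_mul_of_nonneg_left (hqν j) hc.le))
  have stepu : ∀ k δ, 0 ≤ δ → (∀ j j', v k j ≤ (1 + δ) * v k j') →
      ∀ i i', u k i ≤ (1 + (1 - ε) * δ) * u k i' := by
    intro k δ hδ hosc
    refine rescaling_oscillation_le (P := fun j i => A k i j) (u := v k) (ν := μ) hε.le hδ
      (fun j i => hApos k i j) hμ (hArow k) (fun j i => ?_) (hvpos k) hosc (fun i => ?_)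
    · have := mul_le_mul_of_nonneg_right (hεν j) (hμ i).le
      have := hAlow k i j
      linarith
    · simp only [hudef, hB k i _, hvdef]
  have stepv : ∀ k δ, 0 ≤ δ → (∀ i i', u k i ≤ (1 + δ) * u k i') →
      ∀ j j', v (k + 1) j ≤ (1 + (1 - ε) * δ) * v (k + 1) j' := by
    intro k δ hδ hosc
    refine rescaling_oscillation_le (P := B k) (u := u k) (ν := ν) hε.le hδ
      (hBpos k) hν (hBcol k) (fun i j => ?_) (hupos k) hosc (fun j => ?_)
    · have := mul_le_mul_of_nonneg_right (hεμ i) (hν j).le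
      have := hBlow k i j
      linarith
    · simp only [hudef, hA k j _, hvdef]
  obtain ⟨δ, hδ, hδv⟩ := exists_nonneg_forall_ge_of_finite (fun x : κ × κ => v 0 x.1 / v 0 x.2)
  set ρ : ℝ := 1 - ε with hρdef
  have hρ0 : 0 ≤ ρ := by linarith
  have hρ1 : ρ < 1 := by linarith
  have hd : ∀ k, 0 ≤ δ * ρ ^ k := fun k => mul_nonneg hδ (pow_nonneg hρ0 k)
  have hdu : ∀ k, ρ * (δ * ρ ^ k) ≤ δ * ρ ^ k := fun k =>
    mul_le_of_le_one_left (hd k) hρ1.le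
  have hvosc : ∀ k j j', v k j ≤ (1 + δ * ρ ^ k) * v k j' := by
    intro k
    induction k with
    | zero =>
      intro j j'
      have := (div_le_iff₀ (hvpos 0 j')).1 (hδv (j, j'))
      have := hvpos 0 j'
      simp only [pow_zero, mul_one]
      linarith
    | succ k ih =>
      intro j j'
      have h1 := stepu k _ (hd k) ih
      refine (stepv k _ (mul_nonneg hρ0 (hd k)) h1 j j').trans
        (mul_le_mul_of_nonneg_right ?_ (hvpos _ _).le)
      have := mul_le_mul_of_nonneg_left (hdu k) hρ0
      rw [pow_succ]
      linarith
  have huosc : ∀ k i i', u k i ≤ (1 + δ * ρ ^ k) * u k i' := fun k i i' =>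
    (stepu k _ (hd k) (hvosc k) i i').trans
      (mul_le_mul_of_nonneg_right (by linarith [hdu k]) (hupos k i').le)
  have hvlog : ∀ k j, |Real.log (v k j)| ≤ δ * ρ ^ k := fun k =>
    abs_log_le_of_oscillation (a := ν) (r := fun j => ∑ i, A k i j) (hd k)
      (fun j => sum_pos (fun i _ => hApos k i j) univ_nonempty) hνsum
      (by rw [sum_comm]; simp_rw [hArow k, hμsum]) (fun j => rfl) (hvpos k) (hvosc k)
  have hulog : ∀ k i, |Real.log (u k i)| ≤ δ * ρ ^ k := fun k =>
    abs_log_le_of_oscillation (a := μ) (r := fun i => ∑ j, B k i j) (hd k)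
      (fun i => sum_pos (fun j _ => hBpos k i j) univ_nonempty) hμsum
      (by rw [sum_comm]; simp_rw [hBcol k, hνsum]) (fun j => rfl) (hupos k) (huosc k)
  have hlogB : ∀ k i j, Real.log (B k i j) = Real.log (A k i j) + Real.log (v k j) := by
    intro k i j
    rw [hB k i j, Real.log_mul (hApos k i j).ne' (hvpos k j).ne']
  have hlogA : ∀ k i j, Real.log (A (k + 1) i j) = Real.log (B k i j) + Real.log (u k i) := by
    intro k i j
    rw [show A (k + 1) i j = B k i j * u k i from hA k j i,
      Real.log_mul (hBpos k i j).ne' (hupos k i).ne']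
  have hgeom : ∀ i j k, dist (Real.log (A k i j)) (Real.log (A (k + 1) i j)) ≤
      2 * δ * ρ ^ k := by
    intro i j k
    rw [dist_comm, Real.dist_eq, hlogA, hlogB]
    have h1 := abs_le.1 (hvlog k j)
    have h2 := abs_le.1 (hulog k i)
    rw [abs_le]
    constructor <;> linarith [h1.1, h1.2, h2.1, h2.2]
  have hlim : ∀ i j, ∃ l, Tendsto (fun k => Real.log (A k i j)) atTop (𝓝 l) := fun i j =>
    cauchySeq_tendsto_of_complete (cauchySeq_of_le_geometric ρ (2 * δ) hρ1 (hgeom i j))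
  choose L hL using hlim
  refine ⟨L, 2 * δ / (1 - ρ) + δ, ρ, ?_, hρ0, hρ1, fun k i j => ?_⟩
  · have : 0 < 1 - ρ := by linarith
    positivity
  · have h1 := dist_le_of_le_geometric_of_tendsto ρ (2 * δ) hρ1 (hgeom i j) (hL i j) k
    rw [Real.dist_eq, mul_div_right_comm] at h1
    have h1' := abs_le.1 h1
    have h2 := abs_le.1 (hvlog k j)
    have h3 := hd k
    rw [hlogB, add_mul]
    refine ⟨by linarith, abs_le.2 ⟨?_, ?_⟩⟩ <;> linarith [h1'.1, h1'.2, h2.1, h2.2]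

/-- Bernoulli-type bound for the decay of a geometric sequence. -/
lemma natCast_mul_geometric_le {ρ : ℝ} (h0 : 0 ≤ ρ) (k : ℕ) :
    (1 + k * (1 - ρ)) * ρ ^ k ≤ 1 := by
  induction k with
  | zero => simp
  | succ k ih =>
    have hk : (0 : ℝ) ≤ k := k.cast_nonneg
    have hpow := pow_nonneg h0 k
    have : (1 + ((k : ℝ) + 1) * (1 - ρ)) * ρ ≤ 1 + k * (1 - ρ) := by
      nlinarith [mul_nonneg hk (sq_nonneg (1 - ρ)), sq_nonneg (1 - ρ)]
    calc (1 + ((k + 1 : ℕ) : ℝ) * (1 - ρ)) * ρ ^ (k + 1)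
        = ((1 + ((k : ℝ) + 1) * (1 - ρ)) * ρ) * ρ ^ k := by push_cast; ring
      _ ≤ (1 + k * (1 - ρ)) * ρ ^ k := mul_le_mul_of_nonneg_right this hpow
      _ ≤ 1 := ih

/-- A pointwise logarithmic bound controls the symmetrized relative entropy. -/
lemma symm_kl_le_of_abs_log_le {ι κ : Type*} [Fintype ι] [Fintype κ] {P Q : ι → κ → ℝ}
    {b b' : ℝ} (hP : ∀ i j, 0 < P i j) (hQ : ∀ i j, 0 < Q i j)
    (h : ∀ i j, |Real.log (P i j) - Real.log (Q i j)| ≤ b) (hb : 0 ≤ b) (hbb' : b ≤ b') :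
    (∑ i, ∑ j, P i j * Real.log (P i j / Q i j)) + (∑ i, ∑ j, Q i j * Real.log (Q i j / P i j))
      ≤ (∑ i, ∑ j, Q i j * (Real.exp b' + 1)) * b := by
  simp_rw [← sum_add_distrib, sum_mul]
  refine sum_le_sum fun i _ => sum_le_sum fun j _ => ?_
  have h1 := abs_le.1 (h i j)
  have hPQ : P i j ≤ Q i j * Real.exp b' := by
    rw [← Real.log_le_log_iff (hP i j) (mul_pos (hQ i j) (Real.exp_pos _)),
      Real.log_mul (hQ i j).ne' (Real.exp_pos _).ne', Real.log_exp]
    linarith [h1.2]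
  rw [Real.log_div (hP i j).ne' (hQ i j).ne', Real.log_div (hQ i j).ne' (hP i j).ne']
  have h2 := mul_le_mul_of_nonneg_left h1.2 (hP i j).le
  have h3 := mul_le_mul_of_nonneg_left (show Real.log (Q i j) - Real.log (P i j) ≤ b by
    linarith [h1.1]) (hQ i j).le
  have h4 := mul_le_mul_of_nonneg_right hPQ hb
  linarith


/-- **Sinkhorn iterates converge at rate `O(t⁻¹)` in symmetrized KL divergence.**
For positive probability vectors `μ, ν` and a positive initial matrix, the
alternating column/row rescalings (KL projections onto the column- and
row-marginal constraint sets) converge to a positive coupling `π*` of `(μ, ν)`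
with `H(π_t | π*) + H(π* | π_t) ≤ C/t`. -/
theorem sinkhorn_plan_convergence_rate {n m : ℕ} (hn : 0 < n) (hm : 0 < m)
    (μ : Fin n → ℝ) (ν : Fin m → ℝ)
    (hμ : ∀ i, 0 < μ i) (hν : ∀ j, 0 < ν j)
    (hμsum : ∑ i, μ i = 1) (hνsum : ∑ j, ν j = 1)
    (π : ℕ → Matrix (Fin n) (Fin m) ℝ)
    (hπ1 : ∀ i j, 0 < π 1 i j)
    (heven : ∀ t : ℕ, 1 ≤ t → ∀ i j,
      π (2 * t) i j = π (2 * t - 1) i j * ν j / ∑ i', π (2 * t - 1) i' j)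
    (hodd : ∀ t : ℕ, 1 ≤ t → ∀ i j,
      π (2 * t + 1) i j = π (2 * t) i j * μ i / ∑ j', π (2 * t) i j') :
    ∃ (πstar : Matrix (Fin n) (Fin m) ℝ) (C : ℝ),
      (∀ i j, 0 < πstar i j) ∧
      (∀ i, ∑ j, πstar i j = μ i) ∧
      (∀ j, ∑ i, πstar i j = ν j) ∧
      0 < C ∧
      ∀ t : ℕ, 1 ≤ t →
        (∑ i, ∑ j, π t i j * Real.log (π t i j / πstar i j))
          + (∑ i, ∑ j, πstar i j * Real.log (πstar i j / π t i j)) ≤ C / t := by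
  have : Nonempty (Fin n) := ⟨⟨0, hn⟩⟩
  have : Nonempty (Fin m) := ⟨⟨0, hm⟩⟩
  have hcol : ∀ k, IsColRescaling ν (π (2 * k + 1)) (π (2 * k + 2)) := fun k i j => by
    have := heven (k + 1) (by omega) i j
    rwa [show 2 * (k + 1) - 1 = 2 * k + 1 by omega, mul_div_assoc] at this
  have hrow : ∀ k, IsColRescaling μ (fun j i => π (2 * k + 2) i j)
      (fun j i => π (2 * k + 3) i j) := fun k j i => by
    have := hodd (k + 1) (by omega) i j
    rwa [mul_div_assoc] at this
  obtain ⟨c, hc, hcr1⟩ := exists_crossRatioGe hπ1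
  have hπ2 := (hcol 0).pos hν hπ1
  have hcr2 := ((hcol 0).crossRatioGe hν hπ1 hcr1).swap
  obtain ⟨L, D, ρ, hD, hρ0, hρ1, hL⟩ := exists_log_limit_geometric (A := fun k => π (2 * k + 3))
    (B := fun k => π (2 * k + 4)) hμ hν hμsum hνsum hc
    (fun i j => (hrow 0).pos hμ (fun j i => hπ2 i j) j i)
    (fun i => (hrow 0).sum_eq (fun j i => hπ2 i j) i)
    ((hrow 0).crossRatioGe hμ (fun j i => hπ2 i j) hcr2).swap
    (fun i j => by
      have := (hrow 0).le hμ (fun j i => hπ2 i j) hcr2 ((hcol 0).sum_eq hπ1) hνsum j i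
      simp only [mul_zero, zero_add] at this ⊢
      linarith)
    (fun k => hcol (k + 1)) (fun k => hrow (k + 1))
  have hodd_pos : ∀ k i j, 0 < π (2 * k + 1) i j := by
    intro k
    induction k with
    | zero => exact hπ1
    | succ k ih =>
      exact fun i j => (hrow k).pos hμ (fun j i => (hcol k).pos hν ih i j) j i
  have heven_pos : ∀ k i j, 0 < π (2 * k + 2) i j := fun k => (hcol k).pos hν (hodd_pos k)
  have hpos : ∀ t, 1 ≤ t → ∀ i j, 0 < π t i j := by
    intro t ht
    obtain ⟨k, rfl | rfl⟩ : ∃ k, t = 2 * k + 1 ∨ t = 2 * k + 2 := ⟨(t - 1) / 2, by omega⟩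
    · exact hodd_pos k
    · exact heven_pos k
  obtain ⟨b, hb, hbound⟩ : ∃ b : ℝ, 0 ≤ b ∧
      ∀ t : ℕ, 1 ≤ t → ∀ i j, |Real.log (π t i j) - L i j| ≤ b / t := by
    obtain ⟨b₁, hb₁, h₁⟩ := exists_nonneg_forall_ge_of_finite
      (fun x : Fin n × Fin m => |Real.log (π 1 x.1 x.2) - L x.1 x.2|)
    obtain ⟨b₂, hb₂, h₂⟩ := exists_nonneg_forall_ge_of_finite
      (fun x : Fin n × Fin m => |Real.log (π 2 x.1 x.2) - L x.1 x.2|)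
    have hρ : 0 < 1 - ρ := by linarith
    set E : ℝ := D * (2 / (1 - ρ) + 4) with hE
    have hE0 : 0 ≤ E := by positivity
    have hgeom : ∀ k : ℕ, (2 * k + 4) * (D * ρ ^ k) ≤ E := by
      intro k
      have h1 := natCast_mul_geometric_le hρ0 k
      have h2 : ρ ^ k ≤ 1 := pow_le_one₀ hρ0 hρ1.le
      have h3 : k * ρ ^ k ≤ 1 / (1 - ρ) := by
        rw [le_div_iff₀ hρ]
        linarith [pow_nonneg hρ0 k]
      have h4 : (2 * k + 4) * ρ ^ k ≤ 2 / (1 - ρ) + 4 := by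
        rw [show 2 / (1 - ρ) = 2 * (1 / (1 - ρ)) by ring]
        linarith
      rw [mul_left_comm]
      exact mul_le_mul_of_nonneg_left h4 hD
    refine ⟨b₁ + 2 * b₂ + E, by positivity, fun t ht i j => ?_⟩
    have ht0 : (0 : ℝ) < t := by exact_mod_cast ht
    rw [le_div_iff₀ ht0]
    obtain rfl | rfl | ⟨k, rfl | rfl⟩ :
        t = 1 ∨ t = 2 ∨ ∃ k, t = 2 * k + 3 ∨ t = 2 * k + 4 := by
      by_cases h : t ≤ 2
      · omega
      · exact Or.inr (Or.inr ⟨(t - 3) / 2, by omega⟩)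
    · have := h₁ (i, j)
      push_cast
      linarith
    · have := h₂ (i, j)
      push_cast
      linarith
    · have h1 := mul_le_mul_of_nonneg_right (hL k i j).1 ht0.le
      have h2 := hgeom k
      have h3 := mul_nonneg hD (pow_nonneg hρ0 k)
      push_cast at h1 ⊢
      linarith
    · have h1 := mul_le_mul_of_nonneg_right (hL k i j).2 ht0.le
      have h2 := hgeom k
      push_cast at h1 ⊢
      linarith
  have hlim : ∀ i j, Tendsto (fun t => π t i j) atTop (𝓝 (Real.exp (L i j))) := by
    intro i j
    have hlog : Tendsto (fun t => Real.log (π t i j)) atTop (𝓝 (L i j)) := by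
      rw [tendsto_iff_norm_sub_tendsto_zero]
      refine squeeze_zero' (Eventually.of_forall fun t => norm_nonneg _) ?_
        (tendsto_const_div_atTop_nhds_zero_nat b)
      filter_upwards [eventually_ge_atTop 1] with t ht using hbound t ht i j
    refine ((Real.continuous_exp.tendsto _).comp hlog).congr' ?_
    filter_upwards [eventually_ge_atTop 1] with t ht using Real.exp_log (hpos t ht i j)
  have hsub : ∀ r : ℕ, Tendsto (fun k : ℕ => 2 * k + r) atTop atTop := fun r =>
    tendsto_atTop_mono (fun k => by rw [id]; omega) tendsto_id
  set S : ℝ := ∑ i, ∑ j, Real.exp (L i j) * (Real.exp b + 1) with hS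
  have hS0 : 0 ≤ S := by positivity
  refine ⟨fun i j => Real.exp (L i j), S * b + 1, fun i j => Real.exp_pos _, fun i => ?_,
    fun j => ?_, by positivity, fun t ht => ?_⟩
  · refine tendsto_nhds_unique ((tendsto_finsetSum univ fun j _ => hlim i j).comp (hsub 3)) ?_
    refine tendsto_const_nhds.congr fun k => ?_
    exact ((hrow k).sum_eq (fun j i => heven_pos k i j) i).symm
  · refine tendsto_nhds_unique ((tendsto_finsetSum univ fun i _ => hlim i j).comp (hsub 2)) ?_
    refine tendsto_const_nhds.congr fun k => ?_
    exact ((hcol k).sum_eq (hodd_pos k) j).symm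
  · have ht1 : (1 : ℝ) ≤ t := by exact_mod_cast ht
    have ht0 : (0 : ℝ) < t := by linarith
    refine (symm_kl_le_of_abs_log_le (b := b / t) (b' := b) (hpos t ht)
      (fun i j => Real.exp_pos (L i j)) (fun i j => ?_) (by positivity)
      (div_le_self hb ht1)).trans ?_
    · rw [Real.log_exp]
      exact hbound t ht i j
    · rw [← hS, ← mul_div_assoc]
      exact div_le_div_of_nonneg_right (by linarith) ht0.le
end

section
/- Let E be a real inner product space, C1, C2 ⊆ E convex sets, π* ∈ C1, ω* ∈ C2, and π̂ ∈ C1 ∩ C2. Let f, h : E → ℝ be differentiable with gradients ∇f, ∇h, let ρ > 0, and suppose there exist p, q ∈ E with ⟨p, y − π*⟩ ≤ 0 for all y ∈ C1 and ⟨q, y − ω*⟩ ≤ 0 for all y ∈ C2 (i.e., p is in the normal cone to C1 at π* and q is in the normal cone to C2 at ω*), such that the relaxed fixed-point conditions hold: ∇f(ω*) + ρ·(∇h(π*) − ∇h(ω*)) + p = 0 and ∇f(π*) + ρ·(∇h(ω*) − ∇h(π*)) + q = 0. Then ρ·⟨∇h(π*) − ∇h(ω*), π* − ω*⟩ ≤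 ⟨∇f(ω*), π̂ − π*⟩ + ⟨∇f(π*), π̂ − ω*⟩. Equivalently, ρ·(D_h(π*, ω*) + D_h(ω*, π*)) ≤ ⟨∇f(ω*), π̂ − π*⟩ + ⟨∇f(π*), π̂ − ω*⟩, where D_h(x,y) = h(x) − h(y) − ⟨∇h(y), x − y⟩ is the Bregman divergence of h. -/
open scoped RealInnerProductSpace

/-- **Bregman divergence bound at a relaxed fixed point.**
If `(π*, ω*)` satisfies the relaxed fixed-point (stationarity) conditions of the
alternating mirror-descent scheme with mirror map `h`, gradient field `∇f` and
step size `1/ρ`, then for any `π̂ ∈ C1 ∩ C2`,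
`ρ·⟨∇h(π*) − ∇h(ω*), π* − ω*⟩ ≤ ⟨∇f(ω*), π̂ − π*⟩ + ⟨∇f(π*), π̂ − ω*⟩`;
equivalently `ρ·(D_h(π*, ω*) + D_h(ω*, π*))` is bounded by the same quantity. -/
theorem relaxed_fixed_point_bregman_bound
    {E : Type*} [NormedAddCommGroup E] [InnerProductSpace ℝ E]
    (C1 C2 : Set E) (hC1 : Convex ℝ C1) (hC2 : Convex ℝ C2)
    (πstar ωstar πhat : E)
    (hπstar : πstar ∈ C1) (hωstar : ωstar ∈ C2) (hπhat : πhat ∈ C1 ∩ C2)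
    (f h : E → ℝ) (gradf gradh : E → E)
    (hf : ∀ x : E, HasFDerivAt f (innerSL ℝ (gradf x)) x)
    (hh : ∀ x : E, HasFDerivAt h (innerSL ℝ (gradh x)) x)
    (ρ : ℝ) (hρ : 0 < ρ)
    (p q : E)
    (hp : ∀ y ∈ C1, ⟪p, y - πstar⟫ ≤ 0)
    (hq : ∀ y ∈ C2, ⟪q, y - ωstar⟫ ≤ 0)
    (hfix1 : gradf ωstar + ρ • (gradh πstar - gradh ωstar) + p = 0)
    (hfix2 : gradf πstar + ρ • (gradh ωstar - gradh πstar) + q = 0)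
    (Dh : E → E → ℝ)
    (hDh : ∀ x y : E, Dh x y = h x - h y - ⟪gradh y, x - y⟫) :
    ρ * ⟪gradh πstar - gradh ωstar, πstar - ωstar⟫ ≤
        ⟪gradf ωstar, πhat - πstar⟫ + ⟪gradf πstar, πhat - ωstar⟫ ∧
      ρ * (Dh πstar ωstar + Dh ωstar πstar) ≤
        ⟪gradf ωstar, πhat - πstar⟫ + ⟪gradf πstar, πhat - ωstar⟫ := by
  have hp' := hp πhat hπhat.1
  have hq' := hq πhat hπhat.2
  have e1 := congrArg (fun v => ⟪v, πhat - πstar⟫) hfix1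
  have e2 := congrArg (fun v => ⟪v, πhat - ωstar⟫) hfix2
  simp only [inner_add_left, inner_smul_left, inner_sub_left, inner_sub_right, inner_zero_left,
    conj_trivial] at e1 e2 hp' hq'
  have hinner : ρ * ⟪gradh πstar - gradh ωstar, πstar - ωstar⟫ ≤
      ⟪gradf ωstar, πhat - πstar⟫ + ⟪gradf πstar, πhat - ωstar⟫ := by
    simp only [inner_sub_left, inner_sub_right]
    linarith
  have hsymm : Dh πstar ωstar + Dh ωstar πstar =
      ⟪gradh πstar - gradh ωstar, πstar - ωstar⟫ := by
    simp only [hDh, inner_sub_left, inner_sub_right]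
    ring
  exact ⟨hinner, hsymm ▸ hinner⟩
end

section
/- Let E be a finite-dimensional real inner product space, C1, C2 ⊆ E closed convex sets with C1 ∩ C2 nonempty, and κ ≥ 0 with dist(x, C1 ∩ C2) ≤ κ·max(dist(x, C1), dist(x, C2)) for all x ∈ E. Let f, h : E → ℝ be differentiable with gradients ∇f, ∇h, ρ > 0, σ > 0, C_f ≥ 0, and let π* ∈ C1, ω* ∈ C2, p, q ∈ E satisfy: (i) ⟨p, y − π*⟩ ≤ 0 for all y ∈ C1 and ⟨q, y − ω*⟩ ≤ 0 for all y ∈ C2; (ii) ∇f(ω*) + ρ·(∇h(π*) − ∇h(ω*)) + p = 0 and ∇f(π*) + ρ·(∇h(ω*) − ∇h(π*)) + q = 0; (iii) ‖∇f(π*)‖ ≤ C_f and ‖∇f(ω*)‖ ≤ C_f; (iv) ⟨∇h(π*) − ∇h(ω*), π* − ω*⟩ ≥ σ·‖π* − ω*‖² (σ-strong monotonicity of ∇h). Then ‖π* − ω*‖ ≤ C_f·(2κ + 1)/(σ·ρ). -/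
open Metric
open scoped RealInnerProductSpace

/-- **The two half-iterates of the relaxed FGW solver are `O(1/ρ)` apart.**
Under bounded linear regularity of `{C1, C2}`, boundedness of `∇f` at the fixed
point, and `σ`-strong monotonicity of `∇h`, any relaxed fixed point `(π*, ω*)`
satisfies `‖π* − ω*‖ ≤ C_f·(2κ + 1)/(σ·ρ)`. -/
theorem relaxed_fixed_point_distance_bound
    {E : Type*} [NormedAddCommGroup E] [InnerProductSpace ℝ E]
    [FiniteDimensional ℝ E]
    (C1 C2 : Set E) (hC1c : IsClosed C1) (hC2c : IsClosed C2)
    (hC1 : Convex ℝ C1) (hC2 : Convex ℝ C2)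
    (hne : (C1 ∩ C2).Nonempty)
    (κ : ℝ) (hκ : 0 ≤ κ)
    (hblr : ∀ x : E, infDist x (C1 ∩ C2) ≤ κ * max (infDist x C1) (infDist x C2))
    (f h : E → ℝ) (gradf gradh : E → E)
    (hf : ∀ x : E, HasFDerivAt f (innerSL ℝ (gradf x)) x)
    (hh : ∀ x : E, HasFDerivAt h (innerSL ℝ (gradh x)) x)
    (ρ σ Cf : ℝ) (hρ : 0 < ρ) (hσ : 0 < σ) (hCf : 0 ≤ Cf)
    (πstar ωstar : E) (hπstar : πstar ∈ C1) (hωstar : ωstar ∈ C2)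
    (p q : E)
    (hp : ∀ y ∈ C1, ⟪p, y - πstar⟫ ≤ 0)
    (hq : ∀ y ∈ C2, ⟪q, y - ωstar⟫ ≤ 0)
    (hfix1 : gradf ωstar + ρ • (gradh πstar - gradh ωstar) + p = 0)
    (hfix2 : gradf πstar + ρ • (gradh ωstar - gradh πstar) + q = 0)
    (hgradbound1 : ‖gradf πstar‖ ≤ Cf) (hgradbound2 : ‖gradf ωstar‖ ≤ Cf)
    (hmono : ⟪gradh πstar - gradh ωstar, πstar - ωstar⟫ ≥
      σ * ‖πstar - ωstar‖ ^ 2) :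
    ‖πstar - ωstar‖ ≤ Cf * (2 * κ + 1) / (σ * ρ) := by
  obtain ⟨y, hy, hyd⟩ := (hC1c.inter hC2c).exists_infDist_eq_dist hne πstar
  have hπy : ‖y - πstar‖ ≤ κ * ‖πstar - ωstar‖ := by
    rw [← dist_eq_norm, dist_comm, ← hyd]
    refine (hblr πstar).trans (mul_le_mul_of_nonneg_left (max_le ?_ ?_) hκ)
    · rw [infDist_zero_of_mem hπstar]
      exact norm_nonneg _
    · rw [← dist_eq_norm]
      exact infDist_le_dist_of_mem hωstar
  have hωy : ‖y - ωstar‖ ≤ κ * ‖πstar - ωstar‖ + ‖πstar - ωstar‖ := by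
    have := norm_add_le (y - πstar) (πstar - ωstar)
    rw [sub_add_sub_cancel] at this
    linarith
  have hvar : ρ * ⟪gradh πstar - gradh ωstar, πstar - ωstar⟫ ≤
      ⟪gradf ωstar, y - πstar⟫ + ⟪gradf πstar, y - ωstar⟫ := by
    have h1 := hp y hy.1
    have h2 := hq y hy.2
    rw [eq_neg_of_add_eq_zero_right hfix1] at h1
    rw [eq_neg_of_add_eq_zero_right hfix2] at h2
    simp only [inner_neg_left, inner_add_left, inner_sub_left, inner_sub_right,
      real_inner_smul_left] at h1 h2 ⊢
    linarith
  have h1 : ⟪gradf ωstar, y - πstar⟫ ≤ Cf * (κ * ‖πstar - ωstar‖) :=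
    (real_inner_le_norm _ _).trans (mul_le_mul hgradbound2 hπy (norm_nonneg _) hCf)
  have h2 : ⟪gradf πstar, y - ωstar⟫ ≤ Cf * (κ * ‖πstar - ωstar‖ + ‖πstar - ωstar‖) :=
    (real_inner_le_norm _ _).trans (mul_le_mul hgradbound1 hωy (norm_nonneg _) hCf)
  have h3 := mul_le_mul_of_nonneg_left hmono hρ.le
  rcases (norm_nonneg (πstar - ωstar)).eq_or_lt with h0 | h0
  · rw [← h0]
    positivity
  · rw [le_div_iff₀ (mul_pos hσ hρ)]
    refine le_of_mul_le_mul_right ?_ h0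
    linarith
end

section
/- Let E be a finite-dimensional real inner product space, C1, C2 ⊆ E closed convex sets with C1 ∩ C2 nonempty, and for a nonempty closed convex set C let proj_C(x) denote the unique nearest point of C to x. Let f : E → ℝ be differentiable with gradient ∇f satisfying the midpoint identity ∇f((x + y)/2) = (∇f(x) + ∇f(y))/2 for all x, y ∈ E. Let X ⊆ E be nonempty, ε ≥ 0 and M ≥ 0, and let π* ∈ C1, ω* ∈ C2, p, q ∈ E satisfy: (i) ⟨p, y − π*⟩ ≤ 0 for all y ∈ C1 and ⟨q, y − ω*⟩ ≤ 0 for all y ∈ C2; (ii) ∇f(π*) + ∇f(ω*) + p + q = 0; (iii) for m = (π* + ω*)/2: dist(m, X) ≤ ε·‖m − proj_{C1∩C2}(m − ∇f(m))‖ (error-bound condition); (iv) ‖proj_{C1}(x) + proj_{C2}(y) − 2·proj_{C1∩C2}((x + y)/2)‖ ≤ M·‖proj_{C1}(x) − proj_{C2}(y)‖ for all x, y ∈ E. Then dist((π* + ω*)/2, X) ≤ (M·ε/2)·‖π* − ω*‖. -/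
open Metric
open scoped RealInnerProductSpace

/-- If `z` lies in the normal cone of `C` at `x`, then `x` is the only nearest point of `C`
to `x + z`. -/
theorem eq_of_nearest_of_mem_normalCone {E : Type*} [NormedAddCommGroup E]
    [InnerProductSpace ℝ E] {C : Set E} {x z w : E} (hx : x ∈ C)
    (hz : ∀ y ∈ C, ⟪z, y - x⟫ ≤ 0) (hw : w ∈ C)
    (hmin : ∀ y ∈ C, ‖x + z - w‖ ≤ ‖x + z - y‖) : w = x := by
  have hle : ‖z - (w - x)‖ ≤ ‖z‖ := by
    convert hmin x hx using 2 <;> abel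
  have hsq : ‖z - (w - x)‖ ^ 2 ≤ ‖z‖ ^ 2 := by gcongr
  rw [norm_sub_sq_real] at hsq
  have hzero : ‖w - x‖ ^ 2 = 0 :=
    le_antisymm (by linarith [hz w hw]) (sq_nonneg _)
  exact sub_eq_zero.mp (norm_eq_zero.mp (pow_eq_zero_iff two_ne_zero |>.mp hzero))

/-- **Error-bound estimate for the averaged relaxed fixed point.**
Under the summed stationarity condition `∇f(π*) + ∇f(ω*) + p + q = 0` with normal
cone elements `p, q`, the Luo–Tseng-type error bound (iii), and the
projection-averaging inequality (iv), the midpoint `(π* + ω*)/2` satisfies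
`dist((π* + ω*)/2, X) ≤ (M·ε/2)·‖π* − ω*‖`. -/
theorem relaxed_fixed_point_error_bound
    {E : Type*} [NormedAddCommGroup E] [InnerProductSpace ℝ E]
    [FiniteDimensional ℝ E]
    (C1 C2 : Set E) (hC1c : IsClosed C1) (hC2c : IsClosed C2)
    (hC1 : Convex ℝ C1) (hC2 : Convex ℝ C2)
    (hne : (C1 ∩ C2).Nonempty)
    (proj1 proj2 proj12 : E → E)
    (hproj1 : ∀ x : E, proj1 x ∈ C1 ∧ ∀ y ∈ C1, ‖x - proj1 x‖ ≤ ‖x - y‖)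
    (hproj2 : ∀ x : E, proj2 x ∈ C2 ∧ ∀ y ∈ C2, ‖x - proj2 x‖ ≤ ‖x - y‖)
    (hproj12 : ∀ x : E, proj12 x ∈ C1 ∩ C2 ∧ ∀ y ∈ C1 ∩ C2, ‖x - proj12 x‖ ≤ ‖x - y‖)
    (f : E → ℝ) (gradf : E → E)
    (hf : ∀ x : E, HasFDerivAt f (innerSL ℝ (gradf x)) x)
    (hmid : ∀ x y : E, gradf (((1 : ℝ) / 2) • (x + y)) =
      ((1 : ℝ) / 2) • (gradf x + gradf y))
    (X : Set E) (hX : X.Nonempty) (ε M : ℝ) (hε : 0 ≤ ε) (hM : 0 ≤ M)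
    (πstar ωstar : E) (hπstar : πstar ∈ C1) (hωstar : ωstar ∈ C2)
    (p q : E)
    (hp : ∀ y ∈ C1, ⟪p, y - πstar⟫ ≤ 0)
    (hq : ∀ y ∈ C2, ⟪q, y - ωstar⟫ ≤ 0)
    (hsum : gradf πstar + gradf ωstar + p + q = 0)
    (herr : infDist (((1 : ℝ) / 2) • (πstar + ωstar)) X ≤
      ε * ‖((1 : ℝ) / 2) • (πstar + ωstar) -
            proj12 (((1 : ℝ) / 2) • (πstar + ωstar) -
              gradf (((1 : ℝ) / 2) • (πstar + ωstar)))‖)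
    (havg : ∀ x y : E,
      ‖proj1 x + proj2 y - (2 : ℝ) • proj12 (((1 : ℝ) / 2) • (x + y))‖ ≤
        M * ‖proj1 x - proj2 y‖) :
    infDist (((1 : ℝ) / 2) • (πstar + ωstar)) X ≤
      M * ε / 2 * ‖πstar - ωstar‖ := by
  have h1 : proj1 (πstar + p) = πstar :=
    eq_of_nearest_of_mem_normalCone hπstar hp (hproj1 _).1 (hproj1 _).2
  have h2 : proj2 (ωstar + q) = ωstar :=
    eq_of_nearest_of_mem_normalCone hωstar hq (hproj2 _).1 (hproj2 _).2
  have hmidpoint : ((1 : ℝ) / 2) • ((πstar + p) + (ωstar + q)) =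
      ((1 : ℝ) / 2) • (πstar + ωstar) - gradf (((1 : ℝ) / 2) • (πstar + ωstar)) := by
    have hgrad : gradf πstar + gradf ωstar = -(p + q) :=
      eq_neg_of_add_eq_zero_left (by rw [← hsum]; abel)
    rw [hmid, hgrad]
    module
  have hbound := havg (πstar + p) (ωstar + q)
  rw [h1, h2, hmidpoint] at hbound
  set m := ((1 : ℝ) / 2) • (πstar + ωstar) with hm
  have hdouble : πstar + ωstar - (2 : ℝ) • proj12 (m - gradf m) =
      (2 : ℝ) • (m - proj12 (m - gradf m)) := by
    rw [hm]
    module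
  rw [hdouble, norm_smul, Real.norm_two] at hbound
  calc infDist m X ≤ ε * ‖m - proj12 (m - gradf m)‖ := herr
    _ ≤ ε * (M * ‖πstar - ωstar‖ / 2) := by
        gcongr
        linarith
    _ = M * ε / 2 * ‖πstar - ωstar‖ := by ring
end

section
/- Let E be a finite-dimensional real inner product space, C1, C2 ⊆ E closed convex sets with C1 ∩ C2 nonempty, with metric projections proj_{C1}, proj_{C2}, proj_{C1∩C2}. Let f, h : E → ℝ be differentiable with gradients ∇f, ∇h, and assume: (a) ∇f((x + y)/2) = (∇f(x) + ∇f(y))/2 for all x, y ∈ E; (b) ‖∇f(x)‖ ≤ C_f for all x ∈ C1 ∪ C2; (c) ⟨∇h(x) − ∇h(y), x − y⟩ ≥ σ·‖x − y‖² for all x, y ∈ E with σ > 0; (d) dist(x, C1 ∩ C2) ≤ κ·max(dist(x, C1), dist(x, C2)) for all x ∈ E with κ ≥ 0; (e) ‖proj_{C1}(x) + proj_{C2}(y) − 2·proj_{C1∩C2}((x + y)/2)‖ ≤ M·‖proj_{C1}(x) − proj_{C2}(y)‖ for all x, y ∈ E. Let X = { x ∈ C1 ∩ C2 : ∃ u ∈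 N_{C1}(x), ∃ w ∈ N_{C2}(x), ∇f(x) + u + w = 0 } be the critical point set, assume X is nonempty, and assume the error bound: (f) dist(z, X) ≤ ε·‖z − proj_{C1∩C2}(z − ∇f(z))‖ for all z ∈ E. Then for every ρ > 0 and every pair (π*, ω*) with π* ∈ C1, ω* ∈ C2 for which there exist p ∈ N_{C1}(π*) and q ∈ N_{C2}(ω*) with ∇f(ω*) + ρ·(∇h(π*) − ∇h(ω*)) + p = 0 and ∇f(π*) + ρ·(∇h(ω*) − ∇h(π*)) + q = 0, one has dist((π* + ω*)/2, X) ≤ τ/ρ, where τ = (2κ + 1)·ε·C_f·M/(2σ). -/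
open Metric
open scoped RealInnerProductSpace

/-- A point of `C` nearest to `a + p` is `a` whenever `p` is normal to `C` at `a`. -/
theorem eq_of_normal_of_nearest {E : Type*} [NormedAddCommGroup E] [InnerProductSpace ℝ E]
    {C : Set E} {a p b : E} (ha : a ∈ C) (hp : ∀ y ∈ C, ⟪p, y - a⟫ ≤ 0)
    (hb : b ∈ C) (hmin : ∀ y ∈ C, ‖a + p - b‖ ≤ ‖a + p - y‖) : b = a := by
  have h1 := hmin a ha
  rw [add_sub_cancel_left, show a + p - b = p - (b - a) by abel] at h1
  have h2 := norm_sub_sq_real p (b - a)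
  have h3 := hp b hb
  have h4 := pow_le_pow_left₀ (norm_nonneg _) h1 2
  have h5 : ‖b - a‖ = 0 := by
    refine (pow_eq_zero_iff two_ne_zero).mp ?_
    nlinarith [sq_nonneg ‖b - a‖]
  exact sub_eq_zero.mp (norm_eq_zero.mp h5)

/-- Comparing the two stationarity conditions at a common point `x` of the constraint sets
bounds the gap between the two halves of a fixed point. -/
theorem inner_gap_le_of_normal {E : Type*} [NormedAddCommGroup E] [InnerProductSpace ℝ E]
    {a b x u v d p q : E} {ρ c : ℝ}
    (hp : ⟪p, x - a⟫ ≤ 0) (hq : ⟪q, x - b⟫ ≤ 0)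
    (hpe : v + ρ • d + p = 0) (hqe : u - ρ • d + q = 0)
    (hu : ‖u‖ ≤ c) (hv : ‖v‖ ≤ c) :
    ρ * ⟪d, a - b⟫ ≤ c * (‖x - a‖ + ‖x - b‖) := by
  have h1 : ⟪v, x - a⟫ ≤ c * ‖x - a‖ :=
    (real_inner_le_norm _ _).trans (by gcongr)
  have h2 : ⟪u, x - b⟫ ≤ c * ‖x - b‖ :=
    (real_inner_le_norm _ _).trans (by gcongr)
  rw [eq_neg_of_add_eq_zero_right hpe] at hp
  rw [eq_neg_of_add_eq_zero_right hqe] at hq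
  have h3 : ⟪d, a - b⟫ = ⟪d, x - b⟫ - ⟪d, x - a⟫ := by
    rw [← inner_sub_right]
    congr 1
    abel
  simp only [inner_neg_left, inner_add_left, inner_sub_left, real_inner_smul_left] at hp hq
  rw [h3]
  linarith

/-- **Bounded gap between the relaxed FGW solver's fixed points and the strict
critical set (Proposition 2).**
Under the affinity of `∇f` (midpoint identity), the gradient bound on `C1 ∪ C2`,
`σ`-strong monotonicity of `∇h`, bounded linear regularity of `{C1, C2}`, the
projection-averaging inequality, and the Luo–Tseng error bound for the critical
set `X`, every fixed point `(π*, ω*)` of the relaxed scheme with step size `1/ρ`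
satisfies `dist((π* + ω*)/2, X) ≤ τ/ρ` with `τ = (2κ + 1)·ε·C_f·M/(2σ)`. -/
theorem relaxed_fgw_bounded_gap
    {E : Type*} [NormedAddCommGroup E] [InnerProductSpace ℝ E]
    [FiniteDimensional ℝ E]
    (C1 C2 : Set E) (hC1c : IsClosed C1) (hC2c : IsClosed C2)
    (hC1 : Convex ℝ C1) (hC2 : Convex ℝ C2)
    (hne : (C1 ∩ C2).Nonempty)
    (proj1 proj2 proj12 : E → E)
    (hproj1 : ∀ x : E, proj1 x ∈ C1 ∧ ∀ y ∈ C1, ‖x - proj1 x‖ ≤ ‖x - y‖)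
    (hproj2 : ∀ x : E, proj2 x ∈ C2 ∧ ∀ y ∈ C2, ‖x - proj2 x‖ ≤ ‖x - y‖)
    (hproj12 : ∀ x : E, proj12 x ∈ C1 ∩ C2 ∧ ∀ y ∈ C1 ∩ C2, ‖x - proj12 x‖ ≤ ‖x - y‖)
    (f h : E → ℝ) (gradf gradh : E → E)
    (hf : ∀ x : E, HasFDerivAt f (innerSL ℝ (gradf x)) x)
    (hh : ∀ x : E, HasFDerivAt h (innerSL ℝ (gradh x)) x)
    -- (a) the gradient of `f` satisfies the midpoint (affineness) identity
    (hmid : ∀ x y : E, gradf (((1 : ℝ) / 2) • (x + y)) =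
      ((1 : ℝ) / 2) • (gradf x + gradf y))
    -- (b) gradient bound on `C1 ∪ C2`
    (Cf : ℝ) (hCf : 0 ≤ Cf)
    (hgradbound : ∀ x ∈ C1 ∪ C2, ‖gradf x‖ ≤ Cf)
    -- (c) `σ`-strong monotonicity of `∇h`
    (σ : ℝ) (hσ : 0 < σ)
    (hmono : ∀ x y : E, ⟪gradh x - gradh y, x - y⟫ ≥ σ * ‖x - y‖ ^ 2)
    -- (d) bounded linear regularity
    (κ : ℝ) (hκ : 0 ≤ κ)
    (hblr : ∀ x : E, infDist x (C1 ∩ C2) ≤ κ * max (infDist x C1) (infDist x C2))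
    -- (e) projection-averaging inequality
    (M : ℝ) (hM : 0 ≤ M)
    (havg : ∀ x y : E,
      ‖proj1 x + proj2 y - (2 : ℝ) • proj12 (((1 : ℝ) / 2) • (x + y))‖ ≤
        M * ‖proj1 x - proj2 y‖)
    -- the critical point set of the strictly constrained problem
    (X : Set E)
    (hXdef : X = {x : E | x ∈ C1 ∩ C2 ∧ ∃ u w : E,
      (∀ y ∈ C1, ⟪u, y - x⟫ ≤ 0) ∧ (∀ y ∈ C2, ⟪w, y - x⟫ ≤ 0) ∧
      gradf x + u + w = 0})
    (hX : X.Nonempty)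
    -- (f) Luo–Tseng-type error bound
    (ε : ℝ) (hε : 0 ≤ ε)
    (herr : ∀ z : E, infDist z X ≤ ε * ‖z - proj12 (z - gradf z)‖) :
    ∀ ρ : ℝ, 0 < ρ →
    ∀ πstar ωstar : E, πstar ∈ C1 → ωstar ∈ C2 →
    ∀ p q : E,
      (∀ y ∈ C1, ⟪p, y - πstar⟫ ≤ 0) →
      (∀ y ∈ C2, ⟪q, y - ωstar⟫ ≤ 0) →
      gradf ωstar + ρ • (gradh πstar - gradh ωstar) + p = 0 →
      gradf πstar + ρ • (gradh ωstar - gradh πstar) + q = 0 →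
      infDist (((1 : ℝ) / 2) • (πstar + ωstar)) X ≤
        (2 * κ + 1) * ε * Cf * M / (2 * σ) / ρ := by
  intro ρ hρ a b ha hb p q hp hq hpe hqe
  have hgap : ‖a - b‖ ≤ (2 * κ + 1) * Cf / (σ * ρ) := by
    obtain ⟨hx, hxmin⟩ := hproj12 a
    set x := proj12 a
    have hxa : ‖x - a‖ ≤ κ * ‖a - b‖ := by
      calc ‖x - a‖ = ‖a - x‖ := norm_sub_rev _ _
        _ ≤ infDist a (C1 ∩ C2) :=
          (le_infDist hne).2 fun y hy => by simpa [dist_eq_norm] using hxmin y hy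
        _ ≤ κ * max (infDist a C1) (infDist a C2) := hblr a
        _ ≤ κ * ‖a - b‖ := by
          gcongr
          refine max_le ?_ ?_
          · simp [infDist_zero_of_mem ha]
          · simpa [dist_eq_norm] using infDist_le_dist_of_mem (x := a) hb
    have hxb : ‖x - b‖ ≤ ‖x - a‖ + ‖a - b‖ := norm_sub_le_norm_sub_add_norm_sub _ _ _
    have hqe' : gradf a - ρ • (gradh a - gradh b) + q = 0 := by
      rw [← hqe, ← neg_sub (gradh a), smul_neg, sub_eq_add_neg]
    have hinner := inner_gap_le_of_normal (hp x hx.1) (hq x hx.2) hpe hqe'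
      (hgradbound a (Or.inl ha)) (hgradbound b (Or.inr hb))
    have hsq : σ * ρ * ‖a - b‖ ^ 2 ≤ (2 * κ + 1) * Cf * ‖a - b‖ := by
      calc σ * ρ * ‖a - b‖ ^ 2 = ρ * (σ * ‖a - b‖ ^ 2) := by ring
        _ ≤ ρ * ⟪gradh a - gradh b, a - b⟫ := by
          gcongr
          exact hmono a b
        _ ≤ Cf * (‖x - a‖ + ‖x - b‖) := hinner
        _ ≤ Cf * ((2 * κ + 1) * ‖a - b‖) := by
          gcongr
          linarith
        _ = _ := by ring
    rw [le_div_iff₀ (by positivity)]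
    rcases (norm_nonneg (a - b)).eq_or_lt with h0 | h0
    · rw [← h0, zero_mul]
      positivity
    · refine le_of_mul_le_mul_right ?_ h0
      linarith
  have hres : ‖((1 : ℝ) / 2) • (a + b) -
      proj12 (((1 : ℝ) / 2) • (a + b) - gradf (((1 : ℝ) / 2) • (a + b)))‖ ≤
      M * ‖a - b‖ / 2 := by
    have h1 := eq_of_normal_of_nearest ha hp (hproj1 (a + p)).1 (hproj1 (a + p)).2
    have h2 := eq_of_normal_of_nearest hb hq (hproj2 (b + q)).1 (hproj2 (b + q)).2
    have h3 := havg (a + p) (b + q)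
    have hz : ((1 : ℝ) / 2) • (a + b) - gradf (((1 : ℝ) / 2) • (a + b)) =
        ((1 : ℝ) / 2) • (a + p + (b + q)) := by
      rw [hmid, eq_neg_of_add_eq_zero_right hpe, eq_neg_of_add_eq_zero_right hqe]
      module
    rw [h1, h2, ← hz] at h3
    rw [le_div_iff₀ two_pos]
    refine le_trans (le_of_eq ?_) h3
    rw [mul_comm, ← Real.norm_of_nonneg (zero_le_two (α := ℝ)), ← norm_smul,
      Real.norm_of_nonneg zero_le_two]
    congr 1
    module
  calc _ ≤ ε * _ := herr _
    _ ≤ ε * (M * ‖a - b‖ / 2) := by gcongr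
    _ ≤ ε * (M * ((2 * κ + 1) * Cf / (σ * ρ)) / 2) := by gcongr
    _ = _ := by field_simp
end
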